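/- Let M̄ be an L-structure whose theory is NIP and which is κ-saturated for some cardinal κ > |L| + ℵ₀. Let X be an M̄-definable set, M₀ ≼ M̄ an elementary substructure of cardinality less than κ, and μ a Keisler measure on X over M̄ which is definable over M₀ and finitely satisfiable in M₀ (i.e. generically stable over M₀). Then for every M̄-definable subset Y ⊆ X and every ε > 0 there is a set Z ⊆ X definable with parameters from M₀ with μ(Z) < ε such that for every complete type p over M₀ on X with Z ∉ p, not both p ∪ {Y} and p ∪ {X ∖ Y} are μ-wide. -/

import Mathlib

/-!
STATEMENT 7: Generic domination for generically stable measures in NIP theories.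
If `Th(M̄)` is NIP, `M̄` is `κ`-saturated with `κ > |L| + ℵ₀`, `M₀ ≼ M̄` has
cardinality `< κ`, and `μ` is a Keisler measure on a definable set `X` over `M̄`
which is definable over and finitely satisfiable in `M₀`, then for every definable
`Y ⊆ X` and `ε > 0` there is an `M₀`-definable `Z ⊆ X` with `μ Z < ε` such that for
every complete type `p` over `M₀` on `X` with `Z ∉ p`, not both `p ∪ {Y}` and
`p ∪ {X ∖ Y}` are `μ`-wide.
-/

open FirstOrder

universe u v w

/-- `s ⊆ M` is definable by an `L`-formula in one free variable with parameters from `P`. -/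
def DefOver (L : FirstOrder.Language.{u, v}) (M : Type w) [L.Structure M]
    (P : Set M) (s : Set M) : Prop :=
  ∃ (k : ℕ) (φ : L.Formula (Unit ⊕ Fin k)) (c : Fin k → M),
    (∀ j, c j ∈ P) ∧ s = {a | φ.Realize (Sum.elim (fun _ => a) c)}

/-- A subset of the `m`-tuple sort of `M`, definable with parameters from `P`. -/
def DefTupleOver (L : FirstOrder.Language.{u, v}) (M : Type w) [L.Structure M]
    (P : Set M) (m : ℕ) (s : Set (Fin m → M)) : Prop :=
  ∃ (k : ℕ) (φ : L.Formula (Fin m ⊕ Fin k)) (c : Fin k → M),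
    (∀ j, c j ∈ P) ∧ s = {b | φ.Realize (Sum.elim b c)}

/-- A Keisler measure on the definable set `V` over `M`. -/
def IsKeislerMeasureOn (L : FirstOrder.Language.{u, v}) (M : Type w) [L.Structure M]
    (V : Set M) (μ : Set M → ℝ) : Prop :=
  (∀ s, DefOver L M Set.univ s → s ⊆ V → 0 ≤ μ s) ∧ μ V = 1 ∧
    ∀ s t, DefOver L M Set.univ s → DefOver L M Set.univ t → s ⊆ V → t ⊆ V →
      Disjoint s t → μ (s ∪ t) = μ s + μ t

/-- The formula `φ(x, y)` (with `x` of the sort of `V` and `y` an `m`-tuple) is NIP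
in `M`: for some `k` there is no family shattering a set of `k` parameters. -/
def FormulaIsNIPIn (L : FirstOrder.Language.{u, v}) (M : Type w) [L.Structure M]
    {α β : Type} (φ : L.Formula (α ⊕ β)) : Prop :=
  ∃ k : ℕ, ¬∃ (b : Fin k → β → M) (a : Set (Fin k) → α → M),
    ∀ (S : Set (Fin k)) (i : Fin k), φ.Realize (Sum.elim (a S) (b i)) ↔ i ∈ S

/-- The theory of `M` is NIP: every formula, with respect to every partition of its
free variables into two groups, is NIP in `M`. -/
def TheoryIsNIP (L : FirstOrder.Language.{u, v}) (M : Type w) [L.Structure M] : Prop :=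
  ∀ (n m : ℕ) (φ : L.Formula (Fin n ⊕ Fin m)), FormulaIsNIPIn L M φ

/-- `M` is `κ`-saturated: every set of formulas in one free variable with parameters
from a subset of `M` of cardinality `< κ`, finitely satisfiable in `M`, is realized
in `M`. -/
def IsKappaSaturated (L : FirstOrder.Language.{u, v}) (M : Type w) [L.Structure M]
    (κ : Cardinal.{w}) : Prop :=
  ∀ P : Set M, Cardinal.mk P < κ →
    ∀ T : Set ((k : ℕ) × (L.Formula (Unit ⊕ Fin k) × (Fin k → M))),
      (∀ t ∈ T, ∀ j, t.2.2 j ∈ P) →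
      (∀ T₀ ⊆ T, T₀.Finite →
        ∃ a : M, ∀ t ∈ T₀, t.2.1.Realize (Sum.elim (fun _ => a) t.2.2)) →
      ∃ a : M, ∀ t ∈ T, t.2.1.Realize (Sum.elim (fun _ => a) t.2.2)

/-- The Keisler measure `μ` on `V` is definable over the parameter set `P`: for every
formula `φ(x, y)` and `ε > 0` there is a finite partition of the `y`-tuple sort into
`P`-definable sets on each piece of which `b ↦ μ(V ∩ φ(M, b))` varies by at most `ε`. -/
def MeasureDefOver (L : FirstOrder.Language.{u, v}) (M : Type w) [L.Structure M]
    (P : Set M) (V : Set M) (μ : Set M → ℝ) : Prop :=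
  ∀ (m : ℕ) (φ : L.Formula (Unit ⊕ Fin m)) (ε : ℝ), 0 < ε →
    ∃ (r : ℕ) (B : Fin r → Set (Fin m → M)),
      (∀ t, DefTupleOver L M P m (B t)) ∧
      (⋃ t, B t) = Set.univ ∧ Pairwise (Function.onFun Disjoint B) ∧
      ∀ t, ∀ b ∈ B t, ∀ b' ∈ B t,
        |μ (V ∩ {a | φ.Realize (Sum.elim (fun _ => a) b)}) -
            μ (V ∩ {a | φ.Realize (Sum.elim (fun _ => a) b')})| ≤ ε

/-- `μ` is finitely satisfiable in `P`: every `M`-definable subset of `V` of positive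
`μ`-measure contains a point of `P`. -/
def MeasureFinSatIn (L : FirstOrder.Language.{u, v}) (M : Type w) [L.Structure M]
    (P : Set M) (V : Set M) (μ : Set M → ℝ) : Prop :=
  ∀ s, DefOver L M Set.univ s → s ⊆ V → 0 < μ s → ∃ a ∈ s, a ∈ P

/-- A complete type over the parameter set `P` on the definable set `V`: an
ultrafilter on the Boolean algebra of subsets of `V` definable with parameters
from `P`. -/
def IsCompleteTypeOn (L : FirstOrder.Language.{u, v}) (M : Type w) [L.Structure M]
    (P : Set M) (V : Set M) (p : Set (Set M)) : Prop :=
  (∀ s ∈ p, DefOver L M P s ∧ s ⊆ V) ∧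
  V ∈ p ∧ (∅ : Set M) ∉ p ∧
  (∀ s ∈ p, ∀ t ∈ p, s ∩ t ∈ p) ∧
  (∀ s ∈ p, ∀ t, DefOver L M P t → t ⊆ V → s ⊆ t → t ∈ p) ∧
  (∀ s, DefOver L M P s → s ⊆ V → (s ∈ p ∨ (V \ s) ∈ p))

/-- The partial type `p ∪ {Y}` is `μ`-wide: `μ (D ∩ Y) > 0` for every `D ∈ p`. -/
def IsWide {M : Type w} (μ : Set M → ℝ) (p : Set (Set M)) (Y : Set M) : Prop :=
  ∀ D ∈ p, 0 < μ (D ∩ Y)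

section GenericDomination

variable {L : FirstOrder.Language.{u, v}} {M : Type w} [L.Structure M]

lemma definable_setOf_realize {α : Type*} (P : Set M) (φ : L.Formula α) :
    P.Definable L {w | φ.Realize w} :=
  Set.Definable.mono (Set.empty_definable_iff.2 ⟨φ, rfl⟩) (Set.empty_subset P)

lemma definable_iff_exists_fin_params {α : Type*} [Finite α] {P : Set M} {s : Set (α → M)} :
    P.Definable L s ↔ ∃ (k : ℕ) (φ : L.Formula (α ⊕ Fin k)) (c : Fin k → M),
      (∀ j, c j ∈ P) ∧ s = {v | φ.Realize (Sum.elim v c)} := by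
  constructor
  · intro h
    obtain ⟨A, hAP, hA⟩ := Set.definable_iff_finitely_definable.1 h
    obtain ⟨φ, rfl⟩ := Set.definable_iff_exists_formula_sum.1 hA
    let e : ↥(A : Set M) ≃ Fin A.card := A.equivFin
    refine ⟨A.card, φ.relabel (Sum.elim (Sum.inr ∘ e) Sum.inl), fun j => (e.symm j : M),
      fun j => hAP (e.symm j).2, ?_⟩
    ext v
    simp only [Set.mem_ofPred_eq, FirstOrder.Language.Formula.realize_relabel]
    refine iff_of_eq (congrArg φ.Realize ?_)
    funext x
    rcases x with x | x <;> simp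
  · rintro ⟨k, φ, c, hc, rfl⟩
    refine Set.Definable.preimage_map (F := fun v : α → M => Sum.elim v c) ?_
      (definable_setOf_realize P φ)
    rintro (j | j)
    · exact Set.DefinableFun.proj L
    · exact L.definableFun_const α (hc j)

lemma defOver_iff_definable₁ {P : Set M} {s : Set M} : DefOver L M P s ↔ P.Definable₁ L s := by
  rw [Set.Definable₁, definable_iff_exists_fin_params]
  constructor
  · rintro ⟨k, φ, c, hc, rfl⟩
    refine ⟨k, φ.relabel (Sum.map (fun _ => 0) id), c, hc, ?_⟩
    ext v
    simp only [Set.mem_ofPred_eq, FirstOrder.Language.Formula.realize_relabel]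
    refine iff_of_eq (congrArg φ.Realize ?_)
    funext x
    rcases x with x | x <;> simp
  · rintro ⟨k, φ, c, hc, h⟩
    refine ⟨k, φ.relabel (Sum.map (fun _ => ()) id), c, hc, ?_⟩
    ext a
    have ha := Set.ext_iff.1 h (fun _ => a)
    simp only [Set.mem_ofPred_eq, FirstOrder.Language.Formula.realize_relabel] at ha ⊢
    rw [ha]
    refine iff_of_eq (congrArg φ.Realize ?_)
    funext x
    rcases x with x | x <;> simp

namespace DefOver

variable {P : Set M} {s t : Set M}

lemma inter (hs : DefOver L M P s) (ht : DefOver L M P t) : DefOver L M P (s ∩ t) := by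
  rw [defOver_iff_definable₁] at *
  exact Set.Definable.inter hs ht

lemma union (hs : DefOver L M P s) (ht : DefOver L M P t) : DefOver L M P (s ∪ t) := by
  rw [defOver_iff_definable₁] at *
  exact Set.Definable.union hs ht

lemma sdiff (hs : DefOver L M P s) (ht : DefOver L M P t) : DefOver L M P (s \ t) := by
  rw [defOver_iff_definable₁] at *
  exact Set.Definable.sdiff hs ht

lemma mono {Q : Set M} (hs : DefOver L M P s) (hPQ : P ⊆ Q) : DefOver L M Q s := by
  rw [defOver_iff_definable₁] at *
  exact Set.Definable.mono hs hPQ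

lemma empty : DefOver L M P ∅ := by
  rw [defOver_iff_definable₁]
  exact Set.definable_empty

lemma biUnion {ι : Type*} {f : ι → Set M} (hf : ∀ i, DefOver L M P (f i)) (T : Finset ι) :
    DefOver L M P (⋃ i ∈ T, f i) := by
  classical
  induction T using Finset.induction_on with
  | empty => simpa using empty
  | insert i T _ ih => simpa using (hf i).union ih

end DefOver

lemma defOver_update_fiber {P : Set M} {n : ℕ} {W : Set (Fin n → M)} (hW : P.Definable L W)
    (v : Fin n → M) (hv : ∀ i, v i ∈ P) (i : Fin n) :
    DefOver L M P {a | Function.update v i a ∈ W} := by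
  rw [defOver_iff_definable₁]
  refine Set.Definable.preimage_map
    (F := fun x : Fin 1 → M => Function.update v i (x 0)) ?_ hW
  intro j
  by_cases h : j = i
  · subst h
    simpa using Set.DefinableFun.proj L
  · simpa [Function.update_of_ne h] using L.definableFun_const (Fin 1) (hv j)

namespace IsKeislerMeasureOn

variable {V s t : Set M} {μ : Set M → ℝ}

lemma measure_sdiff (hμ : IsKeislerMeasureOn L M V μ) (hs : DefOver L M Set.univ s)
    (ht : DefOver L M Set.univ t) (hst : s ⊆ t) (htV : t ⊆ V) : μ (t \ s) = μ t - μ s := by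
  have h := hμ.2.2 s (t \ s) hs (ht.sdiff hs) (hst.trans htV) (Set.sdiff_subset.trans htV)
    Set.disjoint_sdiff_right
  rw [Set.union_sdiff_cancel hst] at h
  linarith

lemma measure_mono (hμ : IsKeislerMeasureOn L M V μ) (hs : DefOver L M Set.univ s)
    (ht : DefOver L M Set.univ t) (hst : s ⊆ t) (htV : t ⊆ V) : μ s ≤ μ t := by
  have h := hμ.1 (t \ s) (ht.sdiff hs) (Set.sdiff_subset.trans htV)
  rw [hμ.measure_sdiff hs ht hst htV] at h
  linarith

lemma measure_empty (hμ : IsKeislerMeasureOn L M V μ) : μ ∅ = 0 := by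
  have h := hμ.2.2 ∅ ∅ DefOver.empty DefOver.empty (Set.empty_subset _) (Set.empty_subset _)
    (Set.disjoint_empty _)
  rw [Set.union_empty] at h
  linarith

lemma measure_union_le (hμ : IsKeislerMeasureOn L M V μ) (hs : DefOver L M Set.univ s)
    (ht : DefOver L M Set.univ t) (hsV : s ⊆ V) (htV : t ⊆ V) : μ (s ∪ t) ≤ μ s + μ t := by
  have h := hμ.2.2 s (t \ s) hs (ht.sdiff hs) hsV (Set.sdiff_subset.trans htV)
    Set.disjoint_sdiff_right
  rw [Set.union_sdiff_self] at h
  have := hμ.measure_mono (ht.sdiff hs) ht Set.sdiff_subset htV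
  linarith

lemma measure_biUnion_le (hμ : IsKeislerMeasureOn L M V μ) {ι : Type*} {f : ι → Set M}
    (hf : ∀ i, DefOver L M Set.univ (f i)) (hfV : ∀ i, f i ⊆ V) (T : Finset ι) :
    μ (⋃ i ∈ T, f i) ≤ ∑ i ∈ T, μ (f i) := by
  classical
  induction T using Finset.induction_on with
  | empty => simp [hμ.measure_empty]
  | insert i T hi ih =>
    rw [Finset.sum_insert hi, Finset.set_biUnion_insert]
    have := hμ.measure_union_le (hf i) (DefOver.biUnion hf T) (hfV i)
      (Set.iUnion₂_subset fun j _ => hfV j)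
    linarith

end IsKeislerMeasureOn

/-- For a definable measure, the set of parameters at which the measure of a fiber is at least `r`
can be sandwiched between definable sets. -/
lemma MeasureDefOver.exists_definable_level {P V : Set M} {μ : Set M → ℝ}
    (hdef : MeasureDefOver L M P V μ) {n : ℕ} {W : Set (Fin n → M)} (hW : P.Definable L W)
    (i : Fin n) (r : ℝ) {τ : ℝ} (hτ : 0 < τ) :
    ∃ G : Set (Fin n → M), P.Definable L G ∧
      (∀ v, r ≤ μ (V ∩ {a | Function.update v i a ∈ W}) → v ∈ G) ∧
      ∀ v ∈ G, r - τ ≤ μ (V ∩ {a | Function.update v i a ∈ W}) := by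
  classical
  obtain ⟨k, ψ, c, hc, rfl⟩ := definable_iff_exists_fin_params.1 hW
  let g : Fin n ⊕ Fin k → Unit ⊕ Fin (n + k) :=
    Sum.elim (fun j => if j = i then Sum.inl () else Sum.inr (Fin.castAdd k j))
      (fun j => Sum.inr (Fin.natAdd n j))
  have hfib : ∀ v : Fin n → M,
      {a | (ψ.relabel g).Realize (Sum.elim (fun _ => a) (Fin.append v c))} =
        {a | Function.update v i a ∈ {v | ψ.Realize (Sum.elim v c)}} := by
    intro v
    ext a
    simp only [Set.mem_ofPred_eq, FirstOrder.Language.Formula.realize_relabel]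
    refine iff_of_eq (congrArg ψ.Realize ?_)
    funext x
    rcases x with x | x
    · by_cases h : x = i
      · subst h
        simp [g]
      · simp [g, h]
    · simp [g]
  obtain ⟨q, B, hB, hBU, -, hBv⟩ := hdef (n + k) (ψ.relabel g) τ hτ
  have happ : ∀ t, P.Definable L {v : Fin n → M | Fin.append v c ∈ B t} := by
    intro t
    refine Set.Definable.preimage_map (F := fun v : Fin n → M => Fin.append v c) ?_
      (definable_iff_exists_fin_params.2 (hB t))
    intro j
    refine Fin.addCases (fun j => ?_) (fun j => ?_) j
    · simpa using Set.DefinableFun.proj L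
    · simpa using L.definableFun_const (Fin n) (hc j)
  let T : Finset (Fin q) := {t | ∃ v : Fin n → M, Fin.append v c ∈ B t ∧
    r ≤ μ (V ∩ {a | Function.update v i a ∈ {v | ψ.Realize (Sum.elim v c)}})}
  refine ⟨⋃ t ∈ T, {v | Fin.append v c ∈ B t}, Set.definable_biUnion_finset happ T, ?_, ?_⟩
  · intro v hv
    obtain ⟨t, ht⟩ := Set.mem_iUnion.1 (hBU ▸ Set.mem_univ (Fin.append v c))
    exact Set.mem_biUnion (x := t) (Finset.mem_filter.2 ⟨Finset.mem_univ t, v, ht, hv⟩) ht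
  · intro v hv
    obtain ⟨t, htT, ht⟩ := Set.mem_iUnion₂.1 hv
    obtain ⟨v', hv', hr⟩ := (Finset.mem_filter.1 htT).2
    have h := hBv t _ hv' _ ht
    rw [hfib, hfib, abs_le] at h
    linarith [h.2]

/-- One coordinate of a finite definable cover can be moved to a point of `P` lying on a prescribed
side of `Y`, provided every `P`-definable subset of `Z` of non-negligible measure contains points
of `P` on both sides of `Y`. -/
lemma exists_definable_cover_update {P V Z Y : Set M} {μ : Set M → ℝ}
    (hμ : IsKeislerMeasureOn L M V μ) (hdef : MeasureDefOver L M P V μ)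
    (hZ : DefOver L M P Z) (hZV : Z ⊆ V) (hZpos : 0 < μ Z)
    {J : Type*} [Fintype J] [Nonempty J]
    (hsplit : ∀ F, DefOver L M P F → F ⊆ Z → μ Z / (2 * Fintype.card J) ≤ μ F →
      ∀ S : Prop, ∃ a ∈ F, a ∈ P ∧ (a ∈ Y ↔ S))
    {n : ℕ} (W : J → Set (Fin n → M)) (hW : ∀ j, P.Definable L (W j))
    (hcov : ∀ v, ∃ j, v ∈ W j) (i : Fin n) :
    ∃ G : J → Set (Fin n → M), (∀ j, P.Definable L (G j)) ∧ (∀ v, ∃ j, v ∈ G j) ∧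
      ∀ j, ∀ v ∈ G j, (∀ l, v l ∈ P) → ∀ S : Prop,
        ∃ a ∈ P, (a ∈ Y ↔ S) ∧ Function.update v i a ∈ W j := by
  classical
  have hN : (0 : ℝ) < Fintype.card J := by exact_mod_cast Fintype.card_pos
  have hZi : P.Definable L {v : Fin n → M | v i ∈ Z} :=
    (defOver_iff_definable₁.1 hZ).preimage_comp (fun _ => i)
  have hfib : ∀ j v, V ∩ {a | Function.update v i a ∈ W j ∩ {v | v i ∈ Z}} =
      Z ∩ {a | Function.update v i a ∈ W j} := by
    intro j v
    ext a
    simp only [Set.mem_inter_iff, Set.mem_ofPred_eq, Function.update_self]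
    exact ⟨fun h => ⟨h.2.2, h.2.1⟩, fun h => ⟨hZV h.1, h.2, h.1⟩⟩
  choose G hG hGge hGle using fun j => hdef.exists_definable_level ((hW j).inter hZi) i
    (μ Z / Fintype.card J) (div_pos hZpos (mul_pos two_pos hN))
  simp only [hfib] at hGge hGle
  refine ⟨G, hG, ?_, ?_⟩
  · intro v
    have hd : ∀ j, DefOver L M Set.univ (Z ∩ {a | Function.update v i a ∈ W j}) := fun j =>
      (hZ.mono (Set.subset_univ P)).inter (defOver_update_fiber
        ((hW j).mono (Set.subset_univ P)) v (fun _ => Set.mem_univ _) i)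
    have hsum := hμ.measure_biUnion_le hd (fun j => Set.inter_subset_left.trans hZV) Finset.univ
    have hU : (⋃ j ∈ (Finset.univ : Finset J), Z ∩ {a | Function.update v i a ∈ W j}) = Z := by
      ext a
      have := hcov (Function.update v i a)
      simp [this]
    rw [hU] at hsum
    have hconst : ∑ _j : J, μ Z / Fintype.card J = μ Z := by
      rw [Finset.sum_const, Finset.card_univ, nsmul_eq_mul]
      field_simp
    obtain ⟨j, -, hj⟩ := Finset.exists_le_of_sum_le Finset.univ_nonempty (hconst.trans_le hsum)
    exact ⟨j, hGge j v hj⟩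
  · intro j v hv hvP S
    have hle := hGle j v hv
    have heq : μ Z / Fintype.card J - μ Z / (2 * Fintype.card J) =
        μ Z / (2 * Fintype.card J) := by
      field_simp
      ring
    rw [heq] at hle
    obtain ⟨a, ha, haP, haY⟩ := hsplit _ (hZ.inter (defOver_update_fiber (hW j) v hvP i))
      Set.inter_subset_left hle S
    exact ⟨a, haP, haY, ha.2⟩

/-- Some member of a finite definable cover of the `n`-tuples contains tuples from `P` whose
coordinates lie on arbitrarily prescribed sides of `Y`. -/
lemma exists_mem_cover_forall_pattern {P V Z Y : Set M} {μ : Set M → ℝ}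
    (hμ : IsKeislerMeasureOn L M V μ) (hdef : MeasureDefOver L M P V μ) (hP : P.Nonempty)
    (hZ : DefOver L M P Z) (hZV : Z ⊆ V) (hZpos : 0 < μ Z)
    {J : Type*} [Fintype J] [Nonempty J]
    (hsplit : ∀ F, DefOver L M P F → F ⊆ Z → μ Z / (2 * Fintype.card J) ≤ μ F →
      ∀ S : Prop, ∃ a ∈ F, a ∈ P ∧ (a ∈ Y ↔ S))
    {n : ℕ} (W : J → Set (Fin n → M)) (hW : ∀ j, P.Definable L (W j))
    (hcov : ∀ v, ∃ j, v ∈ W j) :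
    ∃ j, ∀ S : Set (Fin n), ∃ v ∈ W j, ∀ i, v i ∈ Y ↔ i ∈ S := by
  classical
  have key : ∀ T : Finset (Fin n), ∃ G : J → Set (Fin n → M),
      (∀ j, P.Definable L (G j)) ∧ (∀ v, ∃ j, v ∈ G j) ∧
      ∀ j, ∀ v ∈ G j, (∀ l, v l ∈ P) → ∀ S : Set (Fin n),
        ∃ v' ∈ W j, (∀ i ∈ T, v' i ∈ Y ↔ i ∈ S) ∧ ∀ i ∉ T, v' i = v i := by
    intro T
    induction T using Finset.induction_on with
    | empty => exact ⟨W, hW, hcov, fun j v hv _ S => ⟨v, hv, by simp, by simp⟩⟩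
    | insert i T hi ih =>
      obtain ⟨G, hG, hGcov, hGS⟩ := ih
      obtain ⟨H, hH, hHcov, hHS⟩ :=
        exists_definable_cover_update hμ hdef hZ hZV hZpos hsplit G hG hGcov i
      refine ⟨H, hH, hHcov, fun j v hv hvP S => ?_⟩
      obtain ⟨a, haP, haY, ha⟩ := hHS j v hv hvP (i ∈ S)
      have hP' : ∀ l, Function.update v i a l ∈ P := by
        intro l
        by_cases h : l = i
        · subst h
          simpa using haP
        · simpa [h] using hvP l
      obtain ⟨v', hv', hT, hT'⟩ := hGS j _ ha hP' S
      refine ⟨v', hv', ?_, ?_⟩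
      · intro l hl
        rcases Finset.mem_insert.1 hl with rfl | hl
        · rw [hT' l hi, Function.update_self, haY]
        · exact hT l hl
      · intro l hl
        rw [Finset.mem_insert, not_or] at hl
        rw [hT' l hl.2, Function.update_of_ne hl.1]
  obtain ⟨G, -, hGcov, hGS⟩ := key Finset.univ
  obtain ⟨a, ha⟩ := hP
  obtain ⟨j, hj⟩ := hGcov fun _ => a
  refine ⟨j, fun S => ?_⟩
  obtain ⟨v, hv, hvS, -⟩ := hGS j _ hj (fun _ => ha) S
  exact ⟨v, hv, fun i => hvS i (Finset.mem_univ i)⟩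

/-- In a NIP theory, the points of `P` in a definable set of positive measure cannot be split by
`Y` on all `P`-definable subsets of arbitrarily small relative measure. -/
lemma TheoryIsNIP.exists_not_split (hNIP : TheoryIsNIP L M) {P V Y : Set M} {μ : Set M → ℝ}
    (hμ : IsKeislerMeasureOn L M V μ) (hdef : MeasureDefOver L M P V μ) (hP : P.Nonempty)
    (hY : DefOver L M Set.univ Y) :
    ∃ N : ℕ, 0 < N ∧ ∀ Z, DefOver L M P Z → Z ⊆ V → 0 < μ Z →
      ∃ F, DefOver L M P F ∧ F ⊆ Z ∧ μ Z / (2 * N) ≤ μ F ∧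
        ((∀ a ∈ F, a ∈ P → a ∈ Y) ∨ ∀ a ∈ F, a ∈ P → a ∉ Y) := by
  classical
  obtain ⟨m, φ, b, -, rfl⟩ := hY
  obtain ⟨k, hk⟩ := hNIP m 1
    (φ.relabel (Sum.elim (fun _ => Sum.inr 0) Sum.inl : Unit ⊕ Fin m → Fin m ⊕ Fin 1))
  have hrel : ∀ (y : Fin m → M) (x : Fin 1 → M),
      (φ.relabel (Sum.elim (fun _ => Sum.inr 0) Sum.inl :
        Unit ⊕ Fin m → Fin m ⊕ Fin 1)).Realize (Sum.elim y x) ↔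
      φ.Realize (Sum.elim (fun _ => x 0) y) := by
    intro y x
    rw [FirstOrder.Language.Formula.realize_relabel]
    refine iff_of_eq (congrArg φ.Realize ?_)
    funext z
    rcases z with z | z <;> simp
  simp only [hrel] at hk
  refine ⟨Fintype.card (Set (Fin k)), Fintype.card_pos, ?_⟩
  by_contra! hcon
  obtain ⟨Z, hZ, hZV, hZpos, hsplit⟩ := hcon
  let W : Set (Fin k) → Set (Fin k → M) := fun S =>
    {v | ∃ y : Fin m → M, ∀ i, φ.Realize (Sum.elim (fun _ => v i) y) ↔ i ∈ S}ᶜ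
  have hW : ∀ S, P.Definable L (W S) := by
    intro S
    refine Set.Definable.compl (Set.Definable.exists_of_finite
      (S := {w : Fin k ⊕ Fin m → M | ∀ i, φ.Realize
        (Sum.elim (fun _ => w (Sum.inl i)) (w ∘ Sum.inr)) ↔ i ∈ S}) ?_)
    rw [Set.ofPred_forall]
    refine Set.definable_iInter_of_finite fun i => ?_
    have h : P.Definable L {w : Fin k ⊕ Fin m → M | φ.Realize
        (Sum.elim (fun _ => w (Sum.inl i)) (w ∘ Sum.inr))} := by
      convert definable_setOf_realize P (φ.relabel (Sum.map (fun _ => i) id)) using 1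
      ext w
      simp only [Set.mem_ofPred_eq, FirstOrder.Language.Formula.realize_relabel]
      refine iff_of_eq (congrArg φ.Realize ?_)
      funext z
      rcases z with z | z <;> simp
    by_cases hi : i ∈ S
    · simpa [hi] using h
    · simp only [hi, iff_false]
      exact h.compl
  have hcov : ∀ v, ∃ S, v ∈ W S := by
    intro v
    by_contra! hv
    simp only [W, Set.notMem_compl_iff, Set.mem_ofPred_eq] at hv
    choose y hy using hv
    exact hk ⟨fun i _ => v i, y, hy⟩
  obtain ⟨S, hS⟩ := exists_mem_cover_forall_pattern hμ hdef hP hZ hZV hZpos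
    (Y := {a | φ.Realize (Sum.elim (fun _ => a) b)}) (fun F hF hFZ hFμ S => by
      obtain ⟨⟨a, ha, haP, haY⟩, a', ha', ha'P, ha'Y⟩ := hsplit F hF hFZ hFμ
      by_cases hS : S
      · exact ⟨a', ha', ha'P, by simpa [hS] using ha'Y⟩
      · exact ⟨a, ha, haP, by simpa [hS] using haY⟩) W hW hcov
  obtain ⟨v, hv, hvS⟩ := hS S
  exact hv ⟨b, hvS⟩

/-- A Keisler measure definable over and finitely satisfiable in `P` admits, for each definable
`Y` in a NIP theory, two `P`-definable pieces, one on which `Y` is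
null and one on which its complement is, covering everything up to measure `ε`. -/
lemma exists_null_pieces (hNIP : TheoryIsNIP L M) {P V Y : Set M} {μ : Set M → ℝ}
    (hV : DefOver L M P V) (hμ : IsKeislerMeasureOn L M V μ) (hdef : MeasureDefOver L M P V μ)
    (hfs : MeasureFinSatIn L M P V μ) (hY : DefOver L M Set.univ Y) {ε : ℝ} (hε : 0 < ε) :
    ∃ D E : Set M, DefOver L M P D ∧ D ⊆ V ∧ DefOver L M P E ∧ E ⊆ V ∧
      μ (D ∩ Y) = 0 ∧ μ (E \ Y) = 0 ∧ μ (V \ (D ∪ E)) < ε := by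
  have up : ∀ {s}, DefOver L M P s → DefOver L M Set.univ s := fun h => h.mono (Set.subset_univ P)
  by_contra! hcon
  have hP : P.Nonempty := by
    obtain ⟨a, -, ha⟩ := hfs V (up hV) subset_rfl (by rw [hμ.2.1]; exact one_pos)
    exact ⟨a, ha⟩
  obtain ⟨N, hN, hsplit⟩ := hNIP.exists_not_split hμ hdef hP hY
  have hN' : (0 : ℝ) < N := by exact_mod_cast hN
  let R : Set ℝ := {r | ∃ D E : Set M, DefOver L M P D ∧ D ⊆ V ∧ DefOver L M P E ∧ E ⊆ V ∧
    μ (D ∩ Y) = 0 ∧ μ (E \ Y) = 0 ∧ μ (V \ (D ∪ E)) = r}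
  have hRne : R.Nonempty := ⟨_, ∅, ∅, DefOver.empty, Set.empty_subset _, DefOver.empty,
    Set.empty_subset _, by simp [hμ.measure_empty], by simp [hμ.measure_empty], rfl⟩
  have hRlb : ∀ r ∈ R, ε ≤ r := by
    rintro r ⟨D, E, hD, hDV, hE, hEV, h1, h2, rfl⟩
    exact hcon D E hD hDV hE hEV h1 h2
  have hRbdd : BddBelow R := ⟨ε, hRlb⟩
  obtain ⟨r, ⟨D, E, hD, hDV, hE, hEV, hDY, hEY, hr⟩, hlt⟩ :=
    exists_lt_of_csInf_lt hRne (lt_add_of_pos_right (sInf R) (div_pos hε (mul_pos two_pos hN')))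
  have hεr := hRlb r ⟨D, E, hD, hDV, hE, hEV, hDY, hEY, hr⟩
  have hZ : DefOver L M P (V \ (D ∪ E)) := hV.sdiff (hD.union hE)
  obtain ⟨F, hF, hFZ, hFμ, hFY⟩ := hsplit _ hZ Set.sdiff_subset (by rw [hr]; linarith)
  have hFV : F ⊆ V := hFZ.trans Set.sdiff_subset
  have hFε : ε / (2 * N) ≤ μ F := by
    refine le_trans ?_ hFμ
    rw [hr]
    gcongr
  have hdiff : μ ((V \ (D ∪ E)) \ F) < sInf R := by
    rw [hμ.measure_sdiff (up hF) (up hZ) hFZ Set.sdiff_subset, hr]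
    linarith
  refine absurd hdiff (not_lt.2 (csInf_le hRbdd ?_))
  have nonpos : ∀ s, DefOver L M Set.univ s → s ⊆ V → (∀ a ∈ s, a ∉ P) → μ s = 0 := by
    intro s hs hsV hsP
    refine le_antisymm (not_lt.1 fun h => ?_) (hμ.1 s hs hsV)
    obtain ⟨a, ha, haP⟩ := hfs s hs hsV h
    exact hsP a ha haP
  rcases hFY with hFY | hFY
  · have h0 : μ (F \ Y) = 0 := nonpos _ ((up hF).sdiff hY) (Set.sdiff_subset.trans hFV)
      fun a ha haP => ha.2 (hFY a ha.1 haP)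
    refine ⟨D, E ∪ F, hD, hDV, hE.union hF, Set.union_subset hEV hFV, hDY, ?_, ?_⟩
    · have h := hμ.measure_union_le ((up hE).sdiff hY) ((up hF).sdiff hY)
        (Set.sdiff_subset.trans hEV) (Set.sdiff_subset.trans hFV)
      rw [Set.union_sdiff_distrib]
      refine le_antisymm (by linarith) (hμ.1 _ (((up hE).sdiff hY).union ((up hF).sdiff hY))
        (Set.union_subset (Set.sdiff_subset.trans hEV) (Set.sdiff_subset.trans hFV)))
    · rw [Set.sdiff_sdiff, Set.union_assoc]
  · have h0 : μ (F ∩ Y) = 0 := nonpos _ ((up hF).inter hY) (Set.inter_subset_left.trans hFV)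
      fun a ha haP => hFY a ha.1 haP ha.2
    refine ⟨D ∪ F, E, hD.union hF, Set.union_subset hDV hFV, hE, hEV, ?_, hEY, ?_⟩
    · have h := hμ.measure_union_le ((up hD).inter hY) ((up hF).inter hY)
        (Set.inter_subset_left.trans hDV) (Set.inter_subset_left.trans hFV)
      rw [Set.union_inter_distrib_right]
      refine le_antisymm (by linarith) (hμ.1 _ (((up hD).inter hY).union ((up hF).inter hY))
        (Set.union_subset (Set.inter_subset_left.trans hDV) (Set.inter_subset_left.trans hFV)))
    · rw [Set.sdiff_sdiff, Set.union_right_comm]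

end GenericDomination

theorem generically_stable_measure_generic_domination
    {L : FirstOrder.Language.{u, v}} {M : Type w} [L.Structure M]
    (hNIP : TheoryIsNIP L M)
    (κ : Cardinal.{w})
    (hκ : Cardinal.lift.{max u v} κ > Cardinal.lift.{w} L.card + Cardinal.aleph0)
    (hsat : IsKappaSaturated L M κ)
    (M₀ : L.ElementarySubstructure M) (hM₀ : Cardinal.mk (M₀ : Set M) < κ)
    (X : Set M) (hX : DefOver L M (M₀ : Set M) X)
    (μ : Set M → ℝ) (hμ : IsKeislerMeasureOn L M X μ)
    (hdef : MeasureDefOver L M (M₀ : Set M) X μ)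
    (hfs : MeasureFinSatIn L M (M₀ : Set M) X μ)
    (Y : Set M) (hY : DefOver L M Set.univ Y) (hYX : Y ⊆ X)
    (ε : ℝ) (hε : 0 < ε) :
    ∃ Z : Set M, DefOver L M (M₀ : Set M) Z ∧ Z ⊆ X ∧ μ Z < ε ∧
      ∀ p : Set (Set M), IsCompleteTypeOn L M (M₀ : Set M) X p → Z ∉ p →
        ¬(IsWide μ p Y ∧ IsWide μ p (X \ Y)) := by
  obtain ⟨D, E, hD, hDX, hE, hEX, hDY, hEY, hlt⟩ := exists_null_pieces hNIP hX hμ hdef hfs hY hε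
  refine ⟨X \ (D ∪ E), hX.sdiff (hD.union hE), Set.sdiff_subset, hlt, ?_⟩
  rintro p ⟨-, -, -, hinter, hup, hmax⟩ hZp ⟨hwY, hwY'⟩
  have hDEp : D ∪ E ∈ p :=
    (hmax _ (hD.union hE) (Set.union_subset hDX hEX)).resolve_right hZp
  rcases hmax D hD hDX with hDp | hDp
  · exact (hwY D hDp).ne' hDY
  · have hEp : E ∈ p := hup _ (hinter _ hDEp _ hDp) E hE hEX fun a ha =>
      ha.1.resolve_left ha.2.2
    refine (hwY' E hEp).ne' ?_
    rw [← Set.inter_sdiff_assoc, Set.inter_eq_left.2 hEX, hEY]
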